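/- For every integer n ≥ 1, the function F_n is differentiable on (0,∞) with F_n'(φ) > 0 for all φ > 0; that is, F_n is strictly increasing on (0,∞). -/

import Mathlib

open MeasureTheory Filter Set

/-- `Fn n φ = (2·(−1)^(n+1)·(n+1)!/φ)·(∑_{k=0}^{n+1} (−1)^k φ^k/k! − e^{−φ})`. -/
noncomputable def Fn (n : ℕ) (φ : ℝ) : ℝ :=
  2 * (-1 : ℝ) ^ (n + 1) * (Nat.factorial (n + 1)) / φ *
    ((∑ k ∈ Finset.range (n + 2), (-1 : ℝ) ^ k * φ ^ k / (Nat.factorial k)) - Real.exp (-φ))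

/-- The signed Taylor remainder `(−1)^m·(∑_{k=0}^{m} (−1)^k x^k/k! − e^{−x})`. -/
noncomputable def expNegRemainder (m : ℕ) (x : ℝ) : ℝ :=
  (-1 : ℝ) ^ m *
    ((∑ k ∈ Finset.range (m + 1), (-1 : ℝ) ^ k * x ^ k / (Nat.factorial k)) - Real.exp (-x))

theorem expNegRemainder_zero_right (m : ℕ) : expNegRemainder m 0 = 0 := by
  simp [expNegRemainder, Finset.sum_range_succ']

theorem hasDerivAt_expNegRemainder_succ (m : ℕ) (x : ℝ) :
    HasDerivAt (expNegRemainder (m + 1)) (expNegRemainder m x) x := by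
  have hsum : HasDerivAt
      (fun y : ℝ => ∑ k ∈ Finset.range (m + 2), (-1 : ℝ) ^ k * y ^ k / (Nat.factorial k))
      (∑ k ∈ Finset.range (m + 2),
        (-1 : ℝ) ^ k * ((k : ℝ) * x ^ (k - 1)) / (Nat.factorial k)) x :=
    HasDerivAt.fun_sum fun k _ => ((hasDerivAt_pow k x).const_mul _).div_const _
  have hexp : HasDerivAt (fun y : ℝ => Real.exp (-y)) (Real.exp (-x) * -1) x :=
    (hasDerivAt_neg x).exp
  have hshift : ∑ k ∈ Finset.range (m + 2),
        (-1 : ℝ) ^ k * ((k : ℝ) * x ^ (k - 1)) / (Nat.factorial k)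
      = -∑ k ∈ Finset.range (m + 1), (-1 : ℝ) ^ k * x ^ k / (Nat.factorial k) := by
    rw [Finset.sum_range_succ', ← Finset.sum_neg_distrib]
    simp only [Nat.cast_zero, zero_mul, mul_zero, zero_div, add_zero]
    refine Finset.sum_congr rfl fun k _ => ?_
    rw [Nat.factorial_succ, Nat.add_sub_cancel]
    push_cast
    field_simp
    ring
  refine ((hsum.sub hexp).const_mul ((-1 : ℝ) ^ (m + 1))).congr_deriv ?_
  rw [hshift, expNegRemainder]
  ring

theorem pos_of_hasDerivAt_pos {f f' : ℝ → ℝ} (h0 : f 0 = 0)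
    (hf : ∀ x, HasDerivAt f (f' x) x) (hf' : ∀ x, 0 < x → 0 < f' x) {x : ℝ} (hx : 0 < x) :
    0 < f x := by
  have hmono : StrictMonoOn f (Set.Ici 0) := by
    refine strictMonoOn_of_deriv_pos (convex_Ici 0)
      (fun y _ => (hf y).continuousAt.continuousWithinAt) fun y hy => ?_
    rw [interior_Ici] at hy
    rw [(hf y).deriv]
    exact hf' y hy
  simpa [h0] using hmono Set.self_mem_Ici hx.le hx

theorem expNegRemainder_pos (m : ℕ) : ∀ {x : ℝ}, 0 < x → 0 < expNegRemainder m x := by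
  induction m with
  | zero => intro x hx; simpa [expNegRemainder] using hx
  | succ m ih =>
    exact pos_of_hasDerivAt_pos (expNegRemainder_zero_right _)
      (hasDerivAt_expNegRemainder_succ m) fun _ => ih

theorem expNegRemainder_lt_mul (m : ℕ) {x : ℝ} (hx : 0 < x) :
    expNegRemainder (m + 2) x < x * expNegRemainder (m + 1) x := by
  refine sub_pos.mp (pos_of_hasDerivAt_pos
    (f := fun y => y * expNegRemainder (m + 1) y - expNegRemainder (m + 2) y)
    (f' := fun y => y * expNegRemainder m y) ?_ (fun y => ?_)
    (fun y hy => mul_pos hy (expNegRemainder_pos m hy)) hx)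
  · simp [expNegRemainder_zero_right]
  · refine (((hasDerivAt_id y).mul (hasDerivAt_expNegRemainder_succ m y)).sub
      (hasDerivAt_expNegRemainder_succ (m + 1) y)).congr_deriv ?_
    simp

theorem Fn_eq_expNegRemainder_div (n : ℕ) :
    Fn n = fun x => 2 * (Nat.factorial (n + 1) : ℝ) * (expNegRemainder (n + 1) x / x) := by
  funext x
  rw [Fn, expNegRemainder]
  ring

theorem hasDerivAt_Fn (n : ℕ) {x : ℝ} (hx : x ≠ 0) :
    HasDerivAt (Fn n) (2 * (Nat.factorial (n + 1) : ℝ) *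
      ((expNegRemainder n x * x - expNegRemainder (n + 1) x * 1) / x ^ 2)) x := by
  rw [Fn_eq_expNegRemainder_div]
  exact ((hasDerivAt_expNegRemainder_succ n x).div (hasDerivAt_id x) hx).const_mul _

/-- For every integer `n ≥ 1`, the function `Fn n` is differentiable on `(0,∞)` with
positive derivative there; that is, `Fn n` is strictly increasing on `(0,∞)`. -/
theorem Fn_deriv_pos (n : ℕ) (hn : 1 ≤ n) :
    (∀ φ : ℝ, 0 < φ → DifferentiableAt ℝ (Fn n) φ ∧ 0 < deriv (Fn n) φ) ∧
    StrictMonoOn (Fn n) (Set.Ioi 0) := by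
  have hderiv : ∀ φ : ℝ, 0 < φ → DifferentiableAt ℝ (Fn n) φ ∧ 0 < deriv (Fn n) φ := by
    intro φ hφ
    have hF := hasDerivAt_Fn n hφ.ne'
    refine ⟨hF.differentiableAt, ?_⟩
    rw [hF.deriv]
    obtain ⟨m, rfl⟩ := Nat.exists_eq_add_of_le' hn
    have hlt := expNegRemainder_lt_mul m hφ
    have hnum : 0 < expNegRemainder (m + 1) φ * φ - expNegRemainder (m + 1 + 1) φ * 1 := by
      linarith
    positivity
  refine ⟨hderiv, strictMonoOn_of_deriv_pos (convex_Ioi 0)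
    (fun φ hφ => (hderiv φ hφ).1.continuousAt.continuousWithinAt) fun φ hφ => ?_⟩
  rw [interior_Ioi] at hφ
  exact (hderiv φ hφ).2
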